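/- arXiv:2212.05994 — 2 statements merged into one kernel-verified Lean document; each statement's English description precedes it below -/
import Mathlib

section
/- For all n ≤ m, dim_F(W_{n,m}) ≤ C(m,n) · (m−1)!/(n−1)!, where C(m,n) is the binomial coefficient. -/
noncomputable section

/-- The free non-unital associative algebra over `F` on countably many generators
`x_0, x_1, x_2, …`, realized as the semigroup algebra of the free semigroup on `ℕ`. -/
abbrev FreeNA (F : Type) [Field F] : Type := MonoidAlgebra F (FreeSemigroup ℕ)

/-- The monomial `x_{a_1} ⋯ x_{a_k}` attached to the list `[a_1, …, a_k]`
(and `0` for the empty list). -/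
def xList (F : Type) [Field F] : List ℕ → FreeNA F
  | [] => 0
  | a :: t => MonoidAlgebra.single (FreeSemigroup.mk a t) 1

/-- `V_m`: the space of multilinear polynomials of degree `m`, spanned by the
monomials `x_{σ(0)} x_{σ(1)} ⋯ x_{σ(m-1)}` for `σ ∈ S_m`. -/
def Vm (F : Type) [Field F] (m : ℕ) : Submodule F (FreeNA F) :=
  Submodule.span F
    (Set.range fun σ : Equiv.Perm (Fin m) =>
      xList F ((List.finRange m).map fun j => (σ j : ℕ)))

/-- A T-ideal: a two-sided ideal of `F⟨X⟩` closed under every algebra endomorphism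
(an algebra endomorphism of the non-unital algebra `F⟨X⟩` being a multiplicative
`F`-linear map). -/
def IsTIdeal (F : Type) [Field F] (I : Submodule F (FreeNA F)) : Prop :=
  (∀ a b : FreeNA F, b ∈ I → a * b ∈ I ∧ b * a ∈ I) ∧
  (∀ ψ : FreeNA F →ₗ[F] FreeNA F, (∀ x y : FreeNA F, ψ (x * y) = ψ x * ψ y) →
    ∀ a ∈ I, ψ a ∈ I)

/-- The smallest T-ideal containing `f`. -/
def TIdealGen (F : Type) [Field F] (f : FreeNA F) : Submodule F (FreeNA F) :=
  sInf {I | IsTIdeal F I ∧ f ∈ I}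

/-- `W_{n,m} = V_m ∩ (x^n)^T`, where `x^n` is the `n`-th power of the variable `x_0`. -/
def Wnm (F : Type) [Field F] (n m : ℕ) : Submodule F (FreeNA F) :=
  Vm F m ⊓ TIdealGen F (xList F (List.replicate n 0))

section partA
variable {F B : Type} [Field F] [Ring B] [Algebra F B]

/-- The derivative of the `k`-th power at `a` in direction `y`. -/
def Ld (k : ℕ) (a y : B) : B := ∑ i ∈ Finset.range k, a ^ i * y * a ^ (k - 1 - i)

theorem Ld_succ (k : ℕ) (a y : B) : Ld (k + 1) a y = a * Ld k a y + y * a ^ k := by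
  unfold Ld
  rw [Finset.sum_range_succ', Finset.mul_sum]
  simp only [pow_zero, one_mul, Nat.add_sub_cancel, Nat.sub_zero]
  congr 1
  refine Finset.sum_congr rfl fun i _ => ?_
  rw [show k - (i + 1) = k - 1 - i by omega, pow_succ']
  simp only [mul_assoc]

theorem exists_poly (k : ℕ) (a y : B) : ∃ p : Polynomial B, p.coeff 0 = a ^ k ∧
    p.coeff 1 = Ld k a y ∧ ∀ t : F, p.eval (algebraMap F B t) = (a + t • y) ^ k := by
  induction k with
  | zero => exact ⟨1, by simp, by simp [Ld, Polynomial.coeff_one], by simp⟩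
  | succ k ih =>
    obtain ⟨p, h0, h1, h2⟩ := ih
    refine ⟨Polynomial.C a * p + Polynomial.C y * p * Polynomial.X, ?_, ?_, ?_⟩
    · simp [h0, pow_succ']
    · rw [Polynomial.coeff_add, Polynomial.coeff_mul_X (n := 0)]
      simp [h0, h1, Ld_succ]
    · intro t
      rw [Polynomial.eval_add, Polynomial.eval_mul_X, Polynomial.eval_C_mul,
        Polynomial.eval_C_mul, h2, pow_succ', add_mul, ← Algebra.commutes, ← Algebra.smul_def,
        smul_mul_assoc]

theorem Ld_mem [CharZero F] (S : Submodule F B) (k : ℕ) (a y : B)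
    (h : ∀ t : F, (a + t • y) ^ k ∈ S) : Ld k a y ∈ S := by
  by_contra hc
  obtain ⟨φ, hφ, hS⟩ := Submodule.exists_le_ker_of_notMem hc
  obtain ⟨p, -, h1, h2⟩ := exists_poly (F := F) k a y
  let q : Polynomial F :=
    ∑ i ∈ Finset.range (p.natDegree + 1), Polynomial.C (φ (p.coeff i)) * Polynomial.X ^ i
  have hq : q = 0 := by
    apply Polynomial.funext
    intro t
    have := hS (h t)
    rw [LinearMap.mem_ker, ← h2, Polynomial.eval_eq_sum_range, map_sum] at this
    simp only [q, Polynomial.eval_finsetSum, Polynomial.eval_mul, Polynomial.eval_C,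
      Polynomial.eval_pow, Polynomial.eval_X, Polynomial.eval_zero]
    rw [← this]
    refine Finset.sum_congr rfl fun i _ => ?_
    rw [← map_pow, ← Algebra.commutes, ← Algebra.smul_def, map_smul, smul_eq_mul, mul_comm]
  have hq1 : q.coeff 1 = φ (p.coeff 1) := by
    simp only [q, Polynomial.finsetSum_coeff, Polynomial.coeff_C_mul_X_pow]
    rw [Finset.sum_ite_eq]
    split_ifs with hh
    · rfl
    · rw [Polynomial.coeff_eq_zero_of_natDegree_lt, map_zero]
      simp at hh; omega
  rw [hq, h1] at hq1
  exact hφ (by simpa using hq1.symm)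

/-- Main algebraic step: the span of `n`-th powers of elements of `A` is closed under
multiplication by elements of `A`. -/
theorem pow_mul_mem [CharZero F] (S : Submodule F B) (A : Submodule F B)
    (hA : ∀ x ∈ A, ∀ y ∈ A, x * y ∈ A) (n : ℕ) (hn : 1 ≤ n)
    (hS : ∀ x ∈ A, x ^ n ∈ S) (a x : B) (ha : a ∈ A) (hx : x ∈ A) :
    a ^ n * x ∈ S ∧ x * a ^ n ∈ S := by
  have hL : ∀ a ∈ A, ∀ y ∈ A, Ld n a y ∈ S := fun a ha y hy =>
    Ld_mem S n a y fun t => hS _ (A.add_mem ha (A.smul_mem t hy))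
  have hpow : ∀ b ∈ A, b ^ (n + 1) ∈ S := by
    intro b hb
    have h1 := hL b hb _ (hA b hb b hb)
    have h2 : Ld n b (b * b) = (n : F) • b ^ (n + 1) := by
      unfold Ld
      rw [Finset.sum_congr rfl (g := fun _ => b ^ (n + 1))]
      · simp [Algebra.smul_def]
      · intro i hi
        have : i < n := Finset.mem_range.1 hi
        rw [← pow_two, ← pow_add, ← pow_add]
        congr 1
        omega
    rw [h2] at h1
    have hn0 : (n : F) ≠ 0 := by
      exact_mod_cast (by omega : n ≠ 0)
    exact (S.smul_mem_iff hn0).1 h1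
  have hL' : Ld (n + 1) a x ∈ S :=
    Ld_mem S (n + 1) a x fun t => hpow _ (A.add_mem ha (A.smul_mem t hx))
  have e1 : Ld (n + 1) a x = Ld n a (x * a) + a ^ n * x := by
    unfold Ld
    rw [Finset.sum_range_succ]
    congr 1
    · refine Finset.sum_congr rfl fun i hi => ?_
      have : i < n := Finset.mem_range.1 hi
      rw [show n + 1 - 1 - i = (n - 1 - i) + 1 by omega, pow_succ']
      simp only [mul_assoc]
    · simp
  have e2 : Ld (n + 1) a x = Ld n a (a * x) + x * a ^ n := by
    rw [Ld_succ]
    congr 1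
    unfold Ld
    rw [Finset.mul_sum]
    refine Finset.sum_congr rfl fun i hi => ?_
    rw [← mul_assoc, ← mul_assoc, ← mul_assoc, ← pow_succ', pow_succ]
  constructor
  · have := S.sub_mem hL' (hL a ha _ (hA x hx a ha))
    rwa [e1, add_sub_cancel_left] at this
  · have := S.sub_mem hL' (hL a ha _ (hA a ha x hx))
    rwa [e2, add_sub_cancel_left] at this
end partA

section partB
/-- Tuples of nonempty words with multilinear concatenation. -/
def Tset (n m : ℕ) : Set (Fin n → List ℕ) :=
  {u | (∀ i, u i ≠ []) ∧ (List.ofFn u).flatten.Perm (List.range m)}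

/-- Encoding of a tuple by its concatenation and its lengths. -/
def Tenc (n : ℕ) (u : Fin n → List ℕ) : List ℕ × (Fin n →₀ ℕ) :=
  ((List.ofFn u).flatten, Finsupp.equivFunOnFinite.symm fun i => (u i).length - 1)

def Tcod (n m : ℕ) : Finset (List ℕ × (Fin n →₀ ℕ)) :=
  (List.range m).permutations.toFinset ×ˢ Finset.finsuppAntidiag Finset.univ (m - n)

theorem Tenc_maps {n m : ℕ} : Set.MapsTo (Tenc n) (Tset n m) (Tcod n m) := by
  rintro u ⟨h1, h2⟩
  simp only [Tcod, Tenc, Finset.coe_product, Set.mem_prod, Finset.mem_coe, List.mem_toFinset,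
    List.mem_permutations, Finset.mem_finsuppAntidiag]
  refine ⟨h2, ?_, by simp⟩
  have hlen := h2.length_eq
  rw [List.length_flatten, List.map_ofFn, List.sum_ofFn, List.length_range] at hlen
  have : ∑ i, (u i).length = ∑ i : Fin n, (((u i).length - 1) + 1) := by
    refine Finset.sum_congr rfl fun i _ => ?_
    have := List.length_pos_iff.2 (h1 i)
    omega
  simp only [Function.comp_apply] at hlen
  rw [this, Finset.sum_add_distrib] at hlen
  simp at hlen
  simp only [Finsupp.equivFunOnFinite_symm_apply_apply]
  omega

theorem Tenc_inj {n m : ℕ} : Set.InjOn (Tenc n) (Tset n m) := by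
  rintro u ⟨h1, h2⟩ v ⟨h1', h2'⟩ h
  simp only [Tenc, Prod.mk.injEq, EmbeddingLike.apply_eq_iff_eq] at h
  obtain ⟨ha, hb⟩ := h
  apply List.ofFn_injective
  rw [List.eq_iff_flatten_eq]
  refine ⟨ha, ?_⟩
  rw [List.map_ofFn, List.map_ofFn]
  congr 1
  funext i
  have := congrFun hb i
  have := List.length_pos_iff.2 (h1 i)
  have := List.length_pos_iff.2 (h1' i)
  simp only [Function.comp_apply]
  omega

theorem Tset_finite (n m : ℕ) : (Tset n m).Finite :=
  Set.Finite.of_injOn Tenc_maps Tenc_inj (Finset.finite_toSet _)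

theorem Tset_card (n m : ℕ) : (Tset_finite n m).toFinset.card ≤
    m.factorial * (n + (m - n) - 1).choose (m - n) := by
  have h : (Tset_finite n m).toFinset.card ≤ (Tcod n m).card := by
    apply Finset.card_le_card_of_injOn (Tenc n)
    · intro u hu
      exact Tenc_maps (by simpa using hu)
    · simpa using Tenc_inj
  refine h.trans ?_
  rw [Tcod, Finset.card_product, Finset.card_finsuppAntidiag_nat_eq_choose]
  apply Nat.mul_le_mul
  · refine (List.toFinset_card_le _).trans ?_
    rw [List.length_permutations, List.length_range]
  · simp

theorem Tset_injective {n m : ℕ} {u : Fin n → List ℕ} (hu : u ∈ Tset n m) :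
    Function.Injective u := by
  obtain ⟨h1, h2⟩ := hu
  have hnd : (List.ofFn u).flatten.Nodup := h2.nodup_iff.2 List.nodup_range
  rw [List.nodup_flatten] at hnd
  have hp := hnd.2
  rw [List.pairwise_ofFn] at hp
  have key : ∀ i j, i < j → u i ≠ u j := by
    intro i j hij he
    have := hp hij
    rw [he] at this
    obtain ⟨x, hx⟩ := List.exists_mem_of_ne_nil _ (h1 j)
    exact this hx hx
  intro i j he
  rcases lt_trichotomy i j with h | h | h
  · exact absurd he (key _ _ h)
  · exact h
  · exact absurd he.symm (key _ _ h)

theorem perm_comp {n : ℕ} (u : Fin n → List ℕ) (σ : Equiv.Perm (Fin n)) :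
    (List.ofFn (u ∘ σ)).flatten.Perm (List.ofFn u).flatten :=
  (Equiv.Perm.ofFn_comp_perm σ u).flatten

theorem Tset_comp {n m : ℕ} {u : Fin n → List ℕ} (hu : u ∈ Tset n m) (σ : Equiv.Perm (Fin n)) :
    u ∘ σ ∈ Tset n m :=
  ⟨fun _ => hu.1 _, (perm_comp u σ).trans hu.2⟩

theorem image_card {β : Type} [DecidableEq β] (n m : ℕ) (f : (Fin n → List ℕ) → β)
    (hf : ∀ u (σ : Equiv.Perm (Fin n)), f (u ∘ σ) = f u) :
    n.factorial * ((Tset_finite n m).toFinset.image f).card ≤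
      m.factorial * (n + (m - n) - 1).choose (m - n) := by
  refine (Finset.mul_card_image_le_card _ _ ?_).trans (Tset_card n m)
  intro b hb
  obtain ⟨u, hu, rfl⟩ := Finset.mem_image.1 hb
  have hu' : u ∈ Tset n m := by simpa using hu
  have : n.factorial = (Finset.univ : Finset (Equiv.Perm (Fin n))).card := by
    rw [Finset.card_univ, Fintype.card_perm, Fintype.card_fin]
  rw [this]
  apply Finset.card_le_card_of_injOn (fun σ : Equiv.Perm (Fin n) => u ∘ (σ : Fin n → Fin n))
  · intro σ _
    simp [hf, Tset_comp hu' σ]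
  · intro σ _ τ _ h
    ext i
    exact congrArg _ (Tset_injective hu' (congrFun h i))

theorem arith (n m : ℕ) (hn : 1 ≤ n) (hnm : n ≤ m) (c : ℕ)
    (h : n.factorial * c ≤ m.factorial * (n + (m - n) - 1).choose (m - n)) :
    c ≤ Nat.choose m n * (Nat.factorial (m - 1) / Nat.factorial (n - 1)) := by
  obtain ⟨k, rfl⟩ : ∃ k, n = k + 1 := ⟨n - 1, by omega⟩
  obtain ⟨d, rfl⟩ : ∃ d, m = k + 1 + d := ⟨m - (k + 1), by omega⟩
  have e1 : k + 1 + (k + 1 + d - (k + 1)) - 1 = k + d := by omega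
  have e2 : k + 1 + d - (k + 1) = d := by omega
  have e3 : k + 1 + d - 1 = k + d := by omega
  rw [e1, e2] at h
  rw [e3, Nat.add_sub_cancel]
  obtain ⟨q, hq⟩ := Nat.factorial_dvd_factorial (show k ≤ k + d by omega)
  rw [hq, Nat.mul_div_cancel_left _ (Nat.factorial_pos _)]
  have a1 := Nat.add_choose_mul_factorial_mul_factorial k d
  have a2 := Nat.add_choose_mul_factorial_mul_factorial (k + 1) d
  have a3 : (k + d).choose d = (k + d).choose k := by
    rw [Nat.choose_symm_add]
  rw [a3] at h
  have hq' : (k + d).choose k * d.factorial = q := by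
    apply Nat.eq_of_mul_eq_mul_left (Nat.factorial_pos k)
    rw [← hq, ← a1, a3]; ring
  apply Nat.le_of_mul_le_mul_left _ (Nat.factorial_pos (k + 1))
  refine h.trans (le_of_eq ?_)
  rw [← a2, ← hq', Nat.choose_symm_add (a := k + 1)]; ring
end partB

section partC
variable (F : Type) [Field F]

/-- The unitization of the free nonunital algebra. -/
abbrev UB : Type := Unitization F (FreeNA F)

/-- Monomials in the unitization. -/
def mon (l : List ℕ) : UB F := (l.map fun i => (Unitization.inr (xList F [i]) : UB F)).prod

theorem xList_mul (a : ℕ) (l : List ℕ) (h : l ≠ []) :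
    xList F [a] * xList F l = xList F (a :: l) := by
  cases l with
  | nil => exact absurd rfl h
  | cons b t =>
    simp only [xList]
    rw [MonoidAlgebra.single_mul_single, one_mul]
    rfl

theorem mon_eq (l : List ℕ) (h : l ≠ []) : mon F l = Unitization.inr (xList F l) := by
  induction l with
  | nil => exact absurd rfl h
  | cons a t ih =>
    by_cases ht : t = []
    · subst ht; simp [mon]
    · have h2 := ih ht
      rw [← xList_mul F a t ht, Unitization.inr_mul, ← h2]
      simp [mon]

theorem mon_flatten (L : List (List ℕ)) : mon F L.flatten = (L.map (mon F)).prod := by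
  induction L with
  | nil => simp [mon]
  | cons l L ih => rw [List.flatten_cons, List.map_cons, List.prod_cons, ← ih]; simp [mon]

/-- The word of an element of the free semigroup. -/
def wd (w : FreeSemigroup ℕ) : List ℕ := w.head :: w.tail

theorem xList_wd (w : FreeSemigroup ℕ) : xList F (wd w) = MonoidAlgebra.single w 1 := rfl

open Classical in
/-- Projection on the multilinear words. -/
def prj (m : ℕ) : FreeNA F →ₗ[F] FreeNA F :=
  (MonoidAlgebra.basis (FreeSemigroup ℕ) F).constr F
    (fun w => if (wd w).Perm (List.range m) then xList F (wd w) else 0)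

open Classical in
theorem prj_xList (m : ℕ) (l : List ℕ) :
    prj F m (xList F l) = if l.Perm (List.range m) then xList F l else 0 := by
  cases l with
  | nil => simp [xList]
  | cons a t =>
    have h := (MonoidAlgebra.basis (FreeSemigroup ℕ) F).constr_basis F
      (fun w => if (wd w).Perm (List.range m) then xList F (wd w) else 0) (FreeSemigroup.mk a t)
    rw [MonoidAlgebra.basis_apply] at h
    exact h

/-- Projection from the unitization. -/
def prjU (m : ℕ) : UB F →ₗ[F] FreeNA F := (prj F m).comp (Unitization.sndHom F F (FreeNA F))

theorem prjU_inr (m : ℕ) (a : FreeNA F) : prjU F m (Unitization.inr a) = prj F m a := by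
  simp [prjU]

/-- Symmetrized product of words. -/
def sg (n : ℕ) (u : Fin n → List ℕ) : FreeNA F :=
  ∑ σ : Equiv.Perm (Fin n), xList F (List.ofFn (u ∘ σ)).flatten

theorem sg_comp (n : ℕ) (u : Fin n → List ℕ) (τ : Equiv.Perm (Fin n)) :
    sg F n (u ∘ τ) = sg F n u := by
  unfold sg
  exact Fintype.sum_equiv (Equiv.mulLeft τ) _ _ fun σ => by
    simp [Function.comp_assoc]

theorem prj_sg_mem (n m : ℕ) (u : Fin n → List ℕ) (hu : ∀ i, u i ≠ []) :
    prj F m (sg F n u) ∈ Submodule.span F (sg F n '' Tset n m) := by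
  classical
  unfold sg
  rw [map_sum]
  by_cases h : (List.ofFn u).flatten.Perm (List.range m)
  · have : ∑ σ : Equiv.Perm (Fin n), prj F m (xList F (List.ofFn (u ∘ σ)).flatten) = sg F n u := by
      refine Finset.sum_congr rfl fun σ _ => ?_
      rw [prj_xList, if_pos ((perm_comp u σ).trans h)]
    rw [this]
    exact Submodule.subset_span ⟨u, ⟨hu, h⟩, rfl⟩
  · rw [Finset.sum_eq_zero]
    · exact Submodule.zero_mem _
    · intro σ _
      rw [prj_xList, if_neg fun h' => h ((perm_comp u σ).symm.trans h')]

theorem prjU_pow_mem [CharZero F] (n m : ℕ) (hn : 1 ≤ n) (a : FreeNA F) :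
    prjU F m ((Unitization.inr a : UB F) ^ n) ∈ Submodule.span F (sg F n '' Tset n m) := by
  classical
  have ha : (Unitization.inr a : UB F) =
      ∑ w ∈ a.coeff.support, a.coeff w • mon F (wd w) := by
    have h1 : a = ∑ w ∈ a.coeff.support, a.coeff w • xList F (wd w) := by
      conv_lhs => rw [← MonoidAlgebra.sum_coeff_single a]
      refine Finset.sum_congr rfl fun w _ => ?_
      rw [xList_wd, MonoidAlgebra.smul_single, smul_eq_mul, mul_one]
    conv_lhs => rw [h1]
    rw [← Unitization.inrHom_apply F F, map_sum]
    refine Finset.sum_congr rfl fun w _ => ?_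
    rw [map_smul, Unitization.inrHom_apply, mon_eq F (wd w) (by simp [wd])]
  let C := a.coeff.support
  let g : FreeSemigroup ℕ → UB F := fun w => a.coeff w • mon F (wd w)
  have hexp : (Unitization.inr a : UB F) ^ n =
      ∑ r ∈ Fintype.piFinset (fun _ : Fin n => C), (List.ofFn fun i => g (r i)).prod := by
    have := (MultilinearMap.mkPiAlgebraFin F n (UB F)).map_sum_finset (fun _ => g) (fun _ => C)
    simp only [MultilinearMap.mkPiAlgebraFin_apply] at this
    rw [← this, List.ofFn_const, List.prod_replicate, ha]
  have hterm : ∀ r : Fin n → FreeSemigroup ℕ, (List.ofFn fun i => g (r i)).prod =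
      (∏ i, a.coeff (r i)) • (Unitization.inr (xList F (List.ofFn fun i => wd (r i)).flatten) :
        UB F) := by
    intro r
    have := (MultilinearMap.mkPiAlgebraFin F n (UB F)).map_smul_univ
      (fun i => a.coeff (r i)) (fun i => mon F (wd (r i)))
    simp only [MultilinearMap.mkPiAlgebraFin_apply] at this
    rw [this, ← mon_eq, mon_flatten, List.map_ofFn]
    · rfl
    · rw [List.flatten_ne_nil_iff]
      exact ⟨wd (r ⟨0, hn⟩), by simp, by simp [wd]⟩
  have hfac : (n.factorial : F) ≠ 0 := by exact_mod_cast n.factorial_ne_zero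
  rw [← Submodule.smul_mem_iff _ hfac, ← map_smul, hexp]
  have hsym : (n.factorial : F) • ∑ r ∈ Fintype.piFinset (fun _ : Fin n => C),
      (List.ofFn fun i => g (r i)).prod =
      ∑ r ∈ Fintype.piFinset (fun _ : Fin n => C), (∏ i, a.coeff (r i)) •
        (Unitization.inr (sg F n fun i => wd (r i)) : UB F) := by
    have h1 : ∀ σ : Equiv.Perm (Fin n), ∑ r ∈ Fintype.piFinset (fun _ : Fin n => C),
        (List.ofFn fun i => g (r i)).prod = ∑ r ∈ Fintype.piFinset (fun _ : Fin n => C),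
        (List.ofFn fun i => g (r (σ i))).prod := by
      intro σ
      symm
      refine Finset.sum_equiv (Equiv.arrowCongr σ.symm (Equiv.refl _)) ?_ ?_
      · intro r
        simp only [Fintype.mem_piFinset]
        constructor
        · intro h i; exact h _
        · intro h i; simpa using h (σ.symm i)
      · intro r _
        rfl
    have h2 : (n.factorial : F) • ∑ r ∈ Fintype.piFinset (fun _ : Fin n => C),
        (List.ofFn fun i => g (r i)).prod = ∑ σ : Equiv.Perm (Fin n),
        ∑ r ∈ Fintype.piFinset (fun _ : Fin n => C), (List.ofFn fun i => g (r (σ i))).prod := by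
      rw [← Finset.sum_congr rfl fun σ _ => h1 σ, Finset.sum_const, Finset.card_univ,
        Fintype.card_perm, Fintype.card_fin, Nat.cast_smul_eq_nsmul]
    rw [h2, Finset.sum_comm]
    refine Finset.sum_congr rfl fun r _ => ?_
    rw [sg, ← Unitization.inrHom_apply F F, map_sum, Finset.smul_sum]
    refine Finset.sum_congr rfl fun σ _ => ?_
    rw [hterm (fun i => r (σ i)), Equiv.prod_comp σ (fun i => a.coeff (r i))]
    rfl
  rw [hsym, map_sum]
  refine Submodule.sum_mem _ fun r _ => ?_
  rw [map_smul, prjU_inr]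
  exact Submodule.smul_mem _ _ (prj_sg_mem F n m _ fun i => by simp [wd])

/-- Span of `n`-th powers in the unitization. -/
def Spow (n : ℕ) : Submodule F (UB F) :=
  Submodule.span F (Set.range fun a : FreeNA F => (Unitization.inr a : UB F) ^ n)

theorem Spow_mul [CharZero F] (n : ℕ) (hn : 1 ≤ n) (b : UB F) (hb : b ∈ Spow F n)
    (x : FreeNA F) : b * Unitization.inr x ∈ Spow F n ∧ Unitization.inr x * b ∈ Spow F n := by
  have key := pow_mul_mem (Spow F n) (LinearMap.range (Unitization.inrHom F F (FreeNA F)))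
    (by
      rintro _ ⟨x, rfl⟩ _ ⟨y, rfl⟩
      exact ⟨x * y, by simp⟩) n hn
    (by
      rintro _ ⟨x, rfl⟩
      exact Submodule.subset_span ⟨x, rfl⟩)
  induction hb using Submodule.span_induction with
  | mem b h =>
    obtain ⟨a, rfl⟩ := h
    exact key _ _ ⟨a, rfl⟩ ⟨x, rfl⟩
  | zero => simp
  | add b c _ _ h1 h2 =>
    rw [add_mul, mul_add]
    exact ⟨add_mem h1.1 h2.1, add_mem h1.2 h2.2⟩
  | smul t b _ h =>
    have e1 : (t • b) * (Unitization.inr x : UB F) = t • (b * (Unitization.inr x : UB F)) :=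
      Algebra.smul_mul_assoc t b _
    have e2 : (Unitization.inr x : UB F) * (t • b) = t • ((Unitization.inr x : UB F) * b) :=
      Algebra.mul_smul_comm t _ b
    rw [e1, e2]
    exact ⟨Submodule.smul_mem _ _ h.1, Submodule.smul_mem _ _ h.2⟩

theorem TIdeal_Spow [CharZero F] (n : ℕ) (hn : 1 ≤ n) :
    IsTIdeal F ((Spow F n).comap (Unitization.inrHom F F (FreeNA F))) := by
  constructor
  · intro a b hb
    simp only [Submodule.mem_comap, Unitization.inrHom_apply, Unitization.inr_mul] at hb ⊢
    exact (Spow_mul F n hn _ hb a).symm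
  · intro ψ hψ a ha
    simp only [Submodule.mem_comap, Unitization.inrHom_apply] at ha ⊢
    let ψ' : FreeNA F →ₙₐ[F] FreeNA F :=
      { toFun := ψ
        map_smul' := fun t x => ψ.map_smul t x
        map_zero' := ψ.map_zero
        map_add' := ψ.map_add
        map_mul' := hψ }
    let Ψ : UB F →ₐ[F] UB F :=
      Unitization.lift ((Unitization.inrNonUnitalAlgHom F (FreeNA F)).comp ψ')
    have hΨ : ∀ x : FreeNA F, Ψ (Unitization.inr x) = Unitization.inr (ψ x) := by
      intro x
      simp [Ψ, ψ']
    rw [← hΨ]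
    have hle : Spow F n ≤ (Spow F n).comap Ψ.toLinearMap := by
      refine Submodule.span_le.2 ?_
      rintro _ ⟨b, rfl⟩
      simp only [SetLike.mem_coe, Submodule.mem_comap, AlgHom.toLinearMap_apply, map_pow, hΨ]
      exact Submodule.subset_span ⟨ψ b, rfl⟩
    exact hle ha

theorem xpow_mem (n : ℕ) (hn : 1 ≤ n) : xList F (List.replicate n 0) ∈
    (Spow F n).comap (Unitization.inrHom F F (FreeNA F)) := by
  simp only [Submodule.mem_comap, Unitization.inrHom_apply]
  rw [← mon_eq F _ (by simp; omega)]
  refine Submodule.subset_span ⟨xList F [0], ?_⟩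
  simp [mon]

theorem prj_Vm (m : ℕ) (b : FreeNA F) (hb : b ∈ Vm F m) : prj F m b = b := by
  classical
  induction hb using Submodule.span_induction with
  | mem b h =>
    obtain ⟨σ, rfl⟩ := h
    simp only
    rw [prj_xList, if_pos]
    have h1 : ((List.finRange m).map fun j => (σ j : ℕ)) =
        ((List.finRange m).map σ).map Fin.val := by simp
    rw [h1]
    have h2 : ((List.finRange m).map σ).Perm (List.finRange m) := by
      rw [← List.ofFn_eq_map]
      have := Equiv.Perm.ofFn_comp_perm σ (fun i : Fin m => i)
      rw [← List.ofFn_id]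
      exact this
    simpa using h2.map Fin.val
  | zero => simp
  | add b c _ _ h1 h2 => rw [map_add, h1, h2]
  | smul t b _ h => rw [map_smul, h]

theorem Wnm_le [CharZero F] (n m : ℕ) (hn : 1 ≤ n) :
    Wnm F n m ≤ Submodule.span F (sg F n '' Tset n m) := by
  rintro b ⟨hb1, hb2⟩
  have hb3 : b ∈ (Spow F n).comap (Unitization.inrHom F F (FreeNA F)) :=
    (Submodule.mem_sInf.1 hb2) _ ⟨TIdeal_Spow F n hn, xpow_mem F n hn⟩
  simp only [Submodule.mem_comap, Unitization.inrHom_apply] at hb3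
  have hle : Spow F n ≤ (Submodule.span F (sg F n '' Tset n m)).comap (prjU F m) := by
    refine Submodule.span_le.2 ?_
    rintro _ ⟨a, rfl⟩
    exact prjU_pow_mem F n m hn a
  have := hle hb3
  rwa [Submodule.mem_comap, prjU_inr, prj_Vm F m b hb1] at this

end partC

/-- `dim W_{n,m} ≤ C(m,n) · (m-1)!/(n-1)!`. -/
theorem dim_Wnm_upper_bound (F : Type) [Field F] [CharZero F] (n m : ℕ)
    (hn : 1 ≤ n) (hnm : n ≤ m) :
    Module.finrank F (Wnm F n m) ≤
      Nat.choose m n * (Nat.factorial (m - 1) / Nat.factorial (n - 1)) := by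
  classical
  have hle := Wnm_le F n m hn
  have himg : sg F n '' Tset n m = (((Tset_finite n m).toFinset.image (sg F n) :
      Finset (FreeNA F)) : Set (FreeNA F)) := by simp
  rw [himg] at hle
  refine (Submodule.finrank_mono hle).trans ?_
  refine (finrank_span_finset_le_card _).trans ?_
  exact arith n m hn hnm _ (image_card n m (sg F n) (sg_comp F n))

end
end

section
/- If n ≤ m and n is coprime to m, then m!/(n−1)! ≤ dim_F(W_{n,m}). -/
noncomputable section

/-! ### Polarization -/

lemma polar_aux {A : Type*} [Ring A] (n : ℕ) (a : Fin n → A) (J : AddSubgroup A)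
    (h : ∀ S : Finset (Fin n), (∑ i, if i ∈ S then 0 else a i) ^ n ∈ J) :
    ∑ π : Equiv.Perm (Fin n), (List.ofFn fun k => a (π k)).prod ∈ J := by
  classical
  have key : ∑ S : Finset (Fin n), ((-1 : ℤ) ^ S.card) • (∑ i, if i ∈ S then 0 else a i) ^ n
      = ∑ π : Equiv.Perm (Fin n), (List.ofFn fun k => a (π k)).prod := by
    have h1 : ∀ S : Finset (Fin n), (∑ i, if i ∈ S then 0 else a i) ^ n
        = ∑ f : Fin n → Fin n, if S ⊆ (Finset.univ.image f)ᶜ then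
            (List.ofFn fun k => a (f k)).prod else 0 := by
      intro S
      have := (MultilinearMap.mkPiAlgebraFin ℤ n A).map_sum
        (fun (_ : Fin n) (i : Fin n) => if i ∈ S then 0 else a i)
      rw [MultilinearMap.mkPiAlgebraFin_apply_const] at this
      rw [this]
      refine Finset.sum_congr rfl fun f _ => ?_
      split_ifs with hS
      · rw [MultilinearMap.mkPiAlgebraFin_apply]
        congr 2
        funext k
        rw [if_neg]
        intro hk
        have := hS hk
        simp at this
      · rw [Finset.not_subset] at hS
        obtain ⟨i, hi, hi'⟩ := hS
        simp at hi'
        obtain ⟨k, rfl⟩ := hi'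
        apply MultilinearMap.map_coord_zero _ k
        simp [hi]
    simp_rw [h1, Finset.smul_sum]
    rw [Finset.sum_comm]
    have h2 : ∀ f : Fin n → Fin n,
        ∑ S : Finset (Fin n), ((-1 : ℤ) ^ S.card) • (if S ⊆ (Finset.univ.image f)ᶜ then
            (List.ofFn fun k => a (f k)).prod else 0)
        = if Function.Bijective f then (List.ofFn fun k => a (f k)).prod else 0 := by
      intro f
      have h3 : ∑ S : Finset (Fin n), ((-1 : ℤ) ^ S.card) • (if S ⊆ (Finset.univ.image f)ᶜ then
            (List.ofFn fun k => a (f k)).prod else 0)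
          = (∑ S ∈ ((Finset.univ.image f)ᶜ).powerset, (-1 : ℤ) ^ S.card) •
            (List.ofFn fun k => a (f k)).prod := by
        rw [Finset.sum_smul]
        simp_rw [smul_ite, smul_zero]
        rw [← Finset.sum_filter]
        refine Finset.sum_congr ?_ fun _ _ => rfl
        ext S
        simp
      rw [h3, Finset.sum_powerset_neg_one_pow_card, ite_smul, one_smul, zero_smul]
      have h4 : ((Finset.univ.image f)ᶜ = ∅) ↔ Function.Bijective f := by
        rw [← Finite.surjective_iff_bijective, Finset.compl_eq_empty_iff, Finset.eq_univ_iff_forall]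
        simp [Function.Surjective]
      simp only [h4]
    simp_rw [h2]
    rw [← Finset.sum_filter]
    symm
    refine Finset.sum_bij (fun π _ => (π : Fin n → Fin n)) ?_ ?_ ?_ ?_
    · intro π _
      exact Finset.mem_filter.mpr ⟨Finset.mem_univ _, π.bijective⟩
    · intro π _ π' _ h
      exact Equiv.coe_fn_injective h
    · intro f hf
      simp only [Finset.mem_filter, Finset.mem_univ, true_and] at hf
      exact ⟨Equiv.ofBijective f hf, Finset.mem_univ _, rfl⟩
    · intro π _
      rfl
  rw [← key]
  exact J.sum_mem fun S _ => J.zsmul_mem (h S) _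

/-! ### Invertibility of `1 + r + ⋯ + r^(n-1)` -/

lemma geom_unit {F A : Type*} [Field F] [CharZero F] [Ring A] [Algebra F A] (r : A) (n m : ℕ)
    (hn : 1 ≤ n) (hm : 1 ≤ m) (hco : Nat.Coprime n m) (hr : r ^ m = 1) :
    ∃ v : A, (∑ j ∈ Finset.range n, r ^ j) * v = 1 := by
  obtain ⟨k, q, hkq⟩ : ∃ k q : ℕ, n * k = 1 + q * m := by
    rcases Nat.eq_or_lt_of_le hm with h1 | h1
    · refine ⟨1, n - 1, ?_⟩
      subst h1
      omega
    · obtain ⟨k, hk, hk'⟩ := Nat.exists_mul_mod_eq_one_of_coprime hco h1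
      refine ⟨k, n * k / m, ?_⟩
      have := Nat.mod_add_div (n * k) m
      rw [hk', mul_comm m] at this
      exact this.symm
  set N := ∑ j ∈ Finset.range m, r ^ j with hN
  have hrN : r * N = N := by
    have := mul_neg_geom_sum r m
    rw [hr, sub_self, sub_mul, one_mul, sub_eq_zero] at this
    exact this.symm
  have hpN : ∀ j : ℕ, r ^ j * N = N := by
    intro j
    induction j with
    | zero => simp
    | succ j ih => rw [pow_succ, mul_assoc, hrN, ih]
  have hNN : N * N = (m : A) * N := by
    have : N * N = ∑ j ∈ Finset.range m, r ^ j * N := by rw [← Finset.sum_mul]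
    rw [this]
    simp [hpN]
  have hqm : ∀ q : ℕ, ∑ j ∈ Finset.range (1 + q * m), r ^ j = 1 + (q : A) * N := by
    intro q
    induction q with
    | zero => simp
    | succ q ih =>
      have : 1 + (q + 1) * m = (1 + q * m) + m := by ring
      rw [this, Finset.sum_range_add, ih]
      have h2 : ∀ x, r ^ (1 + q * m + x) = r * r ^ x := by
        intro x
        rw [pow_add, pow_add, mul_comm q m, pow_mul, hr]; simp
      simp_rw [h2]
      rw [← Finset.mul_sum, ← hN, hrN]
      push_cast
      rw [add_mul, one_mul, add_assoc]
  have hprod : ∀ k : ℕ, (∑ j ∈ Finset.range n, r ^ j) * (∑ i ∈ Finset.range k, r ^ (n * i))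
      = ∑ j ∈ Finset.range (n * k), r ^ j := by
    intro k
    induction k with
    | zero => simp
    | succ k ih =>
      rw [Finset.sum_range_succ, mul_add, ih, Nat.mul_succ, Finset.sum_range_add, Finset.sum_mul]
      congr 1
      refine Finset.sum_congr rfl fun j _ => ?_
      rw [← pow_add, add_comm]
  have hne : (1 + q * m : F) ≠ 0 := by
    have : ((1 + q * m : ℕ) : F) ≠ 0 := Nat.cast_ne_zero.mpr (by omega)
    exact_mod_cast this
  refine ⟨(∑ i ∈ Finset.range k, r ^ (n * i)) * (1 - ((q : F) / (1 + q * m)) • N), ?_⟩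
  rw [← mul_assoc, hprod, hkq, hqm]
  set c : F := (q : F) / (1 + q * m) with hc
  have hq : (q : A) = algebraMap F A q := by simp
  have hm' : (m : A) = algebraMap F A m := by simp
  rw [hm', ← Algebra.smul_def] at hNN
  rw [hq, ← Algebra.smul_def, add_mul, one_mul, mul_sub, mul_one, smul_mul_smul_comm, hNN, smul_smul]
  have : (q : F) = c + q * c * m := by
    rw [hc]; field_simp
  have h4 : (q : F) • N = c • N + (q * c * m : F) • N := by
    rw [← add_smul, ← this]
  rw [h4]
  abel

/-! ### The T-ideal contains the symmetrized products -/

lemma xList_mul_s9 (F : Type) [Field F] {l₁ l₂ : List ℕ} (h₁ : l₁ ≠ []) (h₂ : l₂ ≠ []) :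
    xList F l₁ * xList F l₂ = xList F (l₁ ++ l₂) := by
  cases l₁ with
  | nil => exact absurd rfl h₁
  | cons a s =>
    cases l₂ with
    | nil => exact absurd rfl h₂
    | cons b t =>
      simp only [xList, List.cons_append, MonoidAlgebra.single_mul_single, mul_one]
      rfl

lemma prod_inr (F : Type) [Field F] (L : List (List ℕ)) (hL : L ≠ []) (h : ∀ l ∈ L, l ≠ []) :
    (L.map fun l => (Unitization.inr (xList F l) : Unitization F (FreeNA F))).prod
      = Unitization.inr (xList F L.flatten) := by
  induction L with
  | nil => exact absurd rfl hL
  | cons l L ih =>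
    rcases eq_or_ne L [] with rfl | hL'
    · simp
    · rw [List.map_cons, List.prod_cons, ih hL' fun l hl => h l (List.mem_cons_of_mem _ hl),
        ← Unitization.inr_mul, xList_mul_s9, List.flatten_cons]
      · exact h l List.mem_cons_self
      · intro h0
        rw [List.flatten_eq_nil_iff] at h0
        obtain ⟨l', hl'⟩ := List.exists_mem_of_ne_nil L hL'
        exact h l' (List.mem_cons_of_mem _ hl') (h0 l' hl')

lemma inr_pow_mem (F : Type) [Field F] (n : ℕ) (hn : 1 ≤ n) (I : Submodule F (FreeNA F))
    (hI : IsTIdeal F I) (hx : xList F (List.replicate n 0) ∈ I) (a : FreeNA F) :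
    (Unitization.inr a : Unitization F (FreeNA F)) ^ n
      ∈ (I.map (Unitization.inrHom F F (FreeNA F))).toAddSubgroup := by
  let ψ : FreeNA F →ₙₐ[F] FreeNA F :=
    MonoidAlgebra.liftMagma F (FreeSemigroup.lift fun _ : ℕ => a)
  have hψ : ∀ k : ℕ, (Unitization.inr (ψ (xList F (List.replicate (k + 1) 0))) :
      Unitization F (FreeNA F)) = (Unitization.inr a) ^ (k + 1) := by
    intro k
    induction k with
    | zero =>
      simp [xList, ψ]
      rfl
    | succ k ih =>
      rw [List.replicate_succ, ← List.singleton_append, ← xList_mul_s9 F (by simp) (by simp),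
        map_mul, Unitization.inr_mul, ih, pow_succ' _ (k + 1)]
      congr 2
      simp [xList, ψ]
      rfl
  obtain ⟨k, rfl⟩ : ∃ k, n = k + 1 := ⟨n - 1, by omega⟩
  refine ⟨ψ (xList F (List.replicate (k + 1) 0)), ?_, ?_⟩
  · exact hI.2 (ψ : FreeNA F →ₗ[F] FreeNA F) (fun x y => map_mul ψ x y) _ hx
  · exact hψ k

lemma polar_mem (F : Type) [Field F] (n : ℕ) (hn : 1 ≤ n) (B : Fin n → List ℕ)
    (hB : ∀ i, B i ≠ []) :
    ∑ π : Equiv.Perm (Fin n), xList F (List.ofFn fun k => B (π k)).flatten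
      ∈ TIdealGen F (xList F (List.replicate n 0)) := by
  rw [TIdealGen, Submodule.mem_sInf]
  rintro I ⟨hI, hx⟩
  have := polar_aux n (fun i => (Unitization.inr (xList F (B i)) : Unitization F (FreeNA F)))
    (I.map (Unitization.inrHom F F (FreeNA F))).toAddSubgroup (by
      intro S
      have h1 : (∑ i, if i ∈ S then 0 else
          (Unitization.inr (xList F (B i)) : Unitization F (FreeNA F)))
          = Unitization.inr (∑ i, if i ∈ S then 0 else xList F (B i)) := by
        change _ = Unitization.inrHom F F (FreeNA F) _
        rw [map_sum]
        refine Finset.sum_congr rfl fun i _ => ?_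
        split_ifs
        · simp
        · rfl
      rw [h1]
      exact inr_pow_mem F n hn I hI hx _)
  have h2 : ∀ π : Equiv.Perm (Fin n),
      (List.ofFn fun k => (Unitization.inr (xList F (B (π k))) : Unitization F (FreeNA F))).prod
      = Unitization.inrHom F F (FreeNA F) (xList F (List.ofFn fun k => B (π k)).flatten) := by
    intro π
    have := prod_inr F (List.ofFn fun k => B (π k)) (by
        intro h; rw [List.ofFn_eq_nil_iff] at h; omega) (by
        intro l hl
        rw [List.mem_ofFn] at hl
        obtain ⟨k, rfl⟩ := hl
        exact hB _)
    rw [List.map_ofFn] at this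
    exact this
  simp only [h2] at this
  rw [← map_sum] at this
  obtain ⟨b, hb, hb'⟩ := this
  have hb'' := Unitization.inr_injective hb'
  rw [← hb'']
  exact hb

/-! ### Lists and rotations -/

/-- Extension of a permutation of the first `k` points. -/
def extP (k l : ℕ) : Equiv.Perm (Fin k) →* Equiv.Perm (Fin (k + l)) where
  toFun h := finSumFinEquiv.permCongr (Equiv.sumCongr h (Equiv.refl _))
  map_one' := by
    ext i
    refine Fin.addCases (fun i => ?_) (fun i => ?_) i <;> simp
  map_mul' a b := by
    ext i
    refine Fin.addCases (fun i => ?_) (fun i => ?_) i <;> simp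

lemma extP_castAdd (k l : ℕ) (h : Equiv.Perm (Fin k)) (i : Fin k) :
    extP k l h (Fin.castAdd l i) = Fin.castAdd l (h i) := by
  simp [extP]

lemma extP_natAdd (k l : ℕ) (h : Equiv.Perm (Fin k)) (i : Fin l) :
    extP k l h (Fin.natAdd k i) = Fin.natAdd k i := by
  simp [extP]

lemma extP_injective (k l : ℕ) : Function.Injective (extP k l) := by
  intro a b hab
  ext i
  have := congrArg (fun f => f (Fin.castAdd l i)) hab
  simp only [extP_castAdd] at this
  simpa [Fin.ext_iff] using this

lemma rot_pow (m j : ℕ) (i : Fin (m + 1)) :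
    (((finRotate (m + 1)) ^ j) i : ℕ) = (i + j) % (m + 1) := by
  induction j with
  | zero => simp [Nat.mod_eq_of_lt i.2]
  | succ j ih =>
    rw [pow_succ', Equiv.Perm.mul_apply, finRotate_apply, Fin.val_add, ih]
    simp [← add_assoc]

lemma ofFn_rot {α : Type*} (m j : ℕ) (f : Fin (m + 1) → α) :
    (List.ofFn fun i => f (((finRotate (m + 1)) ^ j) i)) = (List.ofFn f).rotate j := by
  apply List.ext_getElem
  · simp
  · intro i h1 h2
    rw [List.getElem_rotate]
    simp only [List.getElem_ofFn]
    congr 1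
    ext
    rw [rot_pow]
    simp

lemma flatten_rot {α : Type*} (y w : List α) (j : ℕ) (hj : j ≤ y.length) :
    ((y.map (fun a => [a]) ++ [w]).rotate j).flatten = (y ++ w).rotate j := by
  rw [List.rotate_eq_drop_append_take (by simp; omega),
    List.rotate_eq_drop_append_take (by simp; omega)]
  rw [List.drop_append_of_le_length (by simpa), List.take_append_of_le_length (by simpa),
    List.drop_append_of_le_length hj, List.take_append_of_le_length hj]
  have hs : ∀ z : List α, (z.map fun a => [a]).flatten = z := by
    intro z
    induction z with
    | nil => rfl
    | cons a z ih => simp [ih]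
  simp [← List.map_drop, ← List.map_take, hs]

lemma perm_decomp {M : Type*} [AddCommMonoid M] (k : ℕ) (f : Equiv.Perm (Fin (k + 1)) → M) :
    ∑ π, f π = ∑ h : Equiv.Perm (Fin k), ∑ j ∈ Finset.range (k + 1),
      f (extP k 1 h * (finRotate (k + 1)) ^ j) := by
  simp_rw [← Fin.sum_univ_eq_sum_range
    (fun j => f (extP k 1 _ * (finRotate (k + 1)) ^ j)) (k + 1)]
  rw [← Fintype.sum_prod_type']
  symm
  refine Fintype.sum_bijective
    (fun p : Equiv.Perm (Fin k) × Fin (k + 1) => extP k 1 p.1 * (finRotate (k + 1)) ^ (p.2 : ℕ))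
    ?_ _ _ (fun _ => rfl)
  rw [Fintype.bijective_iff_injective_and_card]
  constructor
  · rintro ⟨h, j⟩ ⟨h', j'⟩ heq
    simp only at heq
    have hlast : ∀ (h : Equiv.Perm (Fin k)), extP k 1 h (Fin.last k) = Fin.last k :=
      fun h => extP_natAdd k 1 h 0
    have hr : ∀ (j i : Fin (k + 1)), ((finRotate (k + 1)) ^ (j : ℕ)) i = i + j := by
      intro j i
      ext
      rw [rot_pow, Fin.val_add]
    have hj : j = j' := by
      have := congrArg (fun g => g (Fin.last k - j)) heq
      simp only [Equiv.Perm.mul_apply, hr, sub_add_cancel, hlast] at this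
      have := (extP k 1 h').injective ((hlast h').trans this)
      have h5 : Fin.last k - j + j = Fin.last k - j + j' := by rw [sub_add_cancel, ← this]
      exact add_left_cancel h5
    subst hj
    have := mul_right_cancel heq
    rw [extP_injective k 1 this]
  · simp [Fintype.card_perm, Nat.factorial_succ, mul_comm]

/-- The monomial attached to a permutation. -/
def monoP (F : Type) [Field F] (m : ℕ) (σ : Equiv.Perm (Fin m)) : FreeNA F :=
  xList F ((List.finRange m).map fun j => (σ j : ℕ))

lemma core_mem (F : Type) [Field F] (k l : ℕ) (g : Equiv.Perm (Fin (k + (l + 1)))) :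
    ∑ h : Equiv.Perm (Fin k), ∑ j ∈ Finset.range (k + 1),
      monoP F (k + (l + 1)) (g * extP k (l + 1) h * (finRotate (k + (l + 1))) ^ j)
      ∈ TIdealGen F (xList F (List.replicate (k + 1) 0)) := by
  let w : List ℕ := List.ofFn fun i : Fin (l + 1) => (g (Fin.natAdd k i) : ℕ)
  have := polar_mem F (k + 1) (by omega)
    (Fin.append (fun i : Fin k => [(g (Fin.castAdd (l + 1) i) : ℕ)]) (fun _ : Fin 1 => w)) (by
      intro i
      refine Fin.addCases (fun i => ?_) (fun i => ?_) i <;> simp [w])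
  rw [perm_decomp] at this
  convert this using 5 with h _ j hj
  rw [Finset.mem_range] at hj
  rw [monoP]
  congr 1
  set B := (Fin.append (fun i : Fin k => [(g (Fin.castAdd (l + 1) i) : ℕ)])
    (fun _ : Fin 1 => w)) with hB
  let y : List ℕ := List.ofFn fun i : Fin k => (g (Fin.castAdd (l + 1) (h i)) : ℕ)
  have e1 : (List.ofFn fun i => B (extP k 1 h i)) = y.map (fun a => [a]) ++ [w] := by
    have : (fun i => B (extP k 1 h i)) =
        Fin.append (fun i : Fin k => [(g (Fin.castAdd (l + 1) (h i)) : ℕ)])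
          (fun _ : Fin 1 => w) := by
      funext i
      refine Fin.addCases (fun i => ?_) (fun i => ?_) i
      · rw [extP_castAdd]; simp [hB]
      · rw [extP_natAdd]; simp [hB]
    rw [this, List.ofFn_fin_append]
    simp [y, List.map_ofFn, Function.comp_def]
  have e2 : (List.ofFn fun i => (g (extP k (l + 1) h i) : ℕ)) = y ++ w := by
    have : (fun i => (g (extP k (l + 1) h i) : ℕ)) =
        Fin.append (fun i : Fin k => (g (Fin.castAdd (l + 1) (h i)) : ℕ))
          (fun i : Fin (l + 1) => (g (Fin.natAdd k i) : ℕ)) := by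
      funext i
      refine Fin.addCases (fun i => ?_) (fun i => ?_) i
      · rw [extP_castAdd]; simp
      · rw [extP_natAdd]; simp
    rw [this, List.ofFn_fin_append]
  simp only [Equiv.Perm.mul_apply]
  rw [ofFn_rot k j (fun i => B (extP k 1 h i)), e1, flatten_rot _ _ _ (by simp [y]; omega), ← e2]
  rw [← ofFn_rot (k + l) j (fun i : Fin (k + (l + 1)) => (g (extP k (l + 1) h i) : ℕ)),
    List.ofFn_eq_map]
  rfl

lemma xList_injOn (F : Type) [Field F] :
    ∃ key : List ℕ → FreeSemigroup ℕ, (∀ l, l ≠ [] → xList F l = MonoidAlgebra.single (key l) 1) ∧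
      ∀ l l', l ≠ [] → l' ≠ [] → key l = key l' → l = l' := by
  refine ⟨fun l => ⟨l.headD 0, l.tail⟩, ?_, ?_⟩
  · intro l hl
    cases l with
    | nil => exact absurd rfl hl
    | cons a t => rfl
  · intro l l' hl hl' h
    cases l with
    | nil => exact absurd rfl hl
    | cons a t =>
      cases l' with
      | nil => exact absurd rfl hl'
      | cons b s => simpa using h

lemma monoP_linInd (F : Type) [Field F] (m : ℕ) (hm : 1 ≤ m) :
    LinearIndependent F (monoP F m) := by
  obtain ⟨key, hk1, hk2⟩ := xList_injOn F
  let L : Equiv.Perm (Fin m) → List ℕ := fun σ => (List.finRange m).map fun j => (σ j : ℕ)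
  have hne : ∀ σ, L σ ≠ [] := by
    intro σ h
    have := congrArg List.length h
    simp [L] at this
    omega
  have hinj : Function.Injective fun σ => key (L σ) := by
    intro σ τ h
    have := hk2 _ _ (hne σ) (hne τ) h
    ext j
    have h2 := List.map_inj_left.mp this j (List.mem_finRange j)
    exact h2
  apply LinearIndependent.of_comp (MonoidAlgebra.coeffLinearEquiv F : FreeNA F ≃ₗ[F] _).toLinearMap
  have h1 : ((MonoidAlgebra.coeffLinearEquiv F : FreeNA F ≃ₗ[F] _).toLinearMap ∘ monoP F m)
      = (fun s : FreeSemigroup ℕ => Finsupp.single s (1 : F)) ∘ fun σ => key (L σ) := by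
    funext σ
    simp only [Function.comp, monoP]
    rw [hk1 _ (hne σ)]
    rfl
  rw [h1]
  exact (Finsupp.linearIndependent_single_one F _).comp _ hinj

lemma main_aux (F : Type) [Field F] [CharZero F] (k l : ℕ)
    (hco : Nat.Coprime (k + 1) (k + (l + 1))) :
    Nat.factorial (k + (l + 1)) / Nat.factorial k
      ≤ Module.finrank F (Wnm F (k + 1) (k + (l + 1))) := by
  classical
  set m := k + (l + 1) with hm
  set ρ := finRotate m with hρ
  have hρm : ρ ^ m = 1 := by
    ext i
    have := rot_pow (k + l) m i
    rw [hρ]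
    refine this.trans ?_
    change ((i : ℕ) + m) % m = i
    rw [Nat.add_mod_right, Nat.mod_eq_of_lt i.2]
  let r : MonoidAlgebra F (Equiv.Perm (Fin m)) := MonoidAlgebra.single ρ 1
  have hrj : ∀ j : ℕ, r ^ j = MonoidAlgebra.single (ρ ^ j) 1 := by
    intro j
    simp [r, MonoidAlgebra.single_pow]
  obtain ⟨v, hv⟩ := geom_unit (F := F) r (k + 1) m (by omega) (by omega) hco
    (by rw [hrj, hρm]; rfl)
  let Φ : MonoidAlgebra F (Equiv.Perm (Fin m)) →ₗ[F] FreeNA F :=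
    (Finsupp.linearCombination F (monoP F m)) ∘ₗ (MonoidAlgebra.coeffLinearEquiv F).toLinearMap
  have hΦs : ∀ σ c, Φ (MonoidAlgebra.single σ c) = c • monoP F m σ := by
    intro σ c
    exact Finsupp.linearCombination_single F c σ
  have hΦi : Function.Injective Φ := by
    have h1 : Function.Injective (Finsupp.linearCombination F (monoP F m)) :=
      monoP_linInd F m (by omega)
    intro x y hxy
    exact (MonoidAlgebra.coeffLinearEquiv F).injective (h1 hxy)
  let H : Subgroup (Equiv.Perm (Fin m)) := (extP k (l + 1)).range
  let T : ((Equiv.Perm (Fin m) ⧸ H) → F) →ₗ[F] MonoidAlgebra F (Equiv.Perm (Fin m)) :=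
    { toFun := fun f => ∑ g, MonoidAlgebra.single g (f (QuotientGroup.mk g))
      map_add' := by
        intro f f'
        simp [MonoidAlgebra.single_add, Finset.sum_add_distrib]
      map_smul' := by
        intro c f
        simp [Finset.smul_sum] }
  have hTi : Function.Injective T := by
    intro f f' h
    funext q
    obtain ⟨g, rfl⟩ := QuotientGroup.mk_surjective q
    have := congrArg (fun x => x.coeff g) h
    simpa [T, Finsupp.single_apply] using this
  let Ψ : ((Equiv.Perm (Fin m) ⧸ H) → F) →ₗ[F] FreeNA F :=
    Φ ∘ₗ (LinearMap.mulRight F (∑ j ∈ Finset.range (k + 1), r ^ j)) ∘ₗ T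
  have hΨi : Function.Injective Ψ := by
    intro x y hxy
    have h1 : T x * (∑ j ∈ Finset.range (k + 1), r ^ j)
        = T y * (∑ j ∈ Finset.range (k + 1), r ^ j) := hΦi hxy
    have := congrArg (fun z => z * v) h1
    apply hTi
    simpa only [mul_assoc, hv, mul_one] using this
  have hΨ : ∀ f, Ψ f = ∑ g, f (QuotientGroup.mk g) •
      ∑ j ∈ Finset.range (k + 1), monoP F m (g * ρ ^ j) := by
    intro f
    change Φ ((∑ g, MonoidAlgebra.single g (f (QuotientGroup.mk g))) *
      (∑ j ∈ Finset.range (k + 1), r ^ j)) = _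
    rw [Finset.sum_mul, map_sum]
    refine Finset.sum_congr rfl fun g _ => ?_
    rw [Finset.mul_sum, map_sum, Finset.smul_sum]
    refine Finset.sum_congr rfl fun j _ => ?_
    rw [hrj, MonoidAlgebra.single_mul_single, mul_one, hΦs]
  have hΨ' : ∀ f (h : Equiv.Perm (Fin k)), Ψ f = ∑ g, f (QuotientGroup.mk g) •
      ∑ j ∈ Finset.range (k + 1), monoP F m (g * extP k (l + 1) h * ρ ^ j) := by
    intro f h
    rw [hΨ, ← Equiv.sum_comp (Equiv.mulRight (extP k (l + 1) h))]
    refine Finset.sum_congr rfl fun g _ => ?_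
    congr 2
    apply QuotientGroup.eq.mpr
    simp [H]
  have hmem : ∀ f, Ψ f ∈ Wnm F (k + 1) m := by
    intro f
    refine ⟨?_, ?_⟩
    · rw [hΨ]
      refine Submodule.sum_mem _ fun g _ => Submodule.smul_mem _ _ (Submodule.sum_mem _ fun j _ => ?_)
      exact Submodule.subset_span ⟨g * ρ ^ j, rfl⟩
    · have h1 : ((Nat.factorial k : ℕ) : F) • Ψ f = ∑ g, f (QuotientGroup.mk g) •
          ∑ h : Equiv.Perm (Fin k), ∑ j ∈ Finset.range (k + 1),
            monoP F m (g * extP k (l + 1) h * ρ ^ j) := by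
        simp_rw [Finset.smul_sum (s := (Finset.univ : Finset (Equiv.Perm (Fin k))))]
        rw [Finset.sum_comm]
        simp_rw [← hΨ' f]
        simp [Fintype.card_perm, Nat.cast_smul_eq_nsmul]
      have h2 : ((Nat.factorial k : ℕ) : F) ≠ 0 := Nat.cast_ne_zero.mpr (Nat.factorial_ne_zero k)
      refine (Submodule.smul_mem_iff _ h2).mp ?_
      rw [h1]
      exact Submodule.sum_mem _ fun g _ => Submodule.smul_mem _ _ (core_mem F k l g)
  have hfin : FiniteDimensional F (Wnm F (k + 1) m) := by
    have : FiniteDimensional F (Vm F m) := FiniteDimensional.span_of_finite F (Set.finite_range _)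
    exact Submodule.finiteDimensional_of_le (inf_le_left : Wnm F (k + 1) m ≤ Vm F m)
  have hle := LinearMap.finrank_le_finrank_of_injective
    (f := Ψ.codRestrict (Wnm F (k + 1) m) hmem) (by
      intro a b hab
      exact hΨi (congrArg Subtype.val hab))
  rw [Module.finrank_fintype_fun_eq_card] at hle
  refine le_trans (le_of_eq ?_) hle
  have hc := Subgroup.card_eq_card_quotient_mul_card_subgroup H
  have hH : Nat.card H = Nat.factorial k := by
    have := Nat.card_congr (MonoidHom.ofInjective (extP_injective k (l + 1))).toEquiv
    rw [← this, Nat.card_eq_fintype_card, Fintype.card_perm, Fintype.card_fin]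
  rw [hH, Nat.card_eq_fintype_card, Fintype.card_perm, Fintype.card_fin,
    Nat.card_eq_fintype_card] at hc
  rw [hc, Nat.mul_div_cancel _ (Nat.factorial_pos k)]

/-- If `n` is coprime to `m` then `m!/(n-1)! ≤ dim W_{n,m}`. -/
theorem dim_Wnm_lower_bound_coprime (F : Type) [Field F] [CharZero F] (n m : ℕ)
    (hn : 1 ≤ n) (hnm : n ≤ m) (hco : Nat.Coprime n m) :
    Nat.factorial m / Nat.factorial (n - 1) ≤ Module.finrank F (Wnm F n m) := by
  obtain ⟨k, rfl⟩ : ∃ k, n = k + 1 := ⟨n - 1, by omega⟩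
  obtain ⟨l, rfl⟩ : ∃ l, m = k + (l + 1) := ⟨m - (k + 1), by omega⟩
  exact main_aux F k l hco

end
end
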